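/- There is an absolute constant c > 0 such that the following holds. Let X be a set of n entities with piecewise-linear trajectories of τ edges each, let ε ≥ 0, m ≥ 1, δ ≥ 0, and assume all connect and disconnect events of all pairs of entities occur at pairwise distinct times. Then for every time s ∈ [t_0, t_τ], the number of distinct maximal groups (G, I_G) whose interval I_G has left endpoint s is at most c·n. -/

import Mathlib

open Set

/-- The plane with the Euclidean metric. -/
abbrev Plane : Type := EuclideanSpace ℝ (Fin 2)

/-- `f` is a piecewise-linear trajectory with breakpoints `t 0, …, t τ`:
it is (the restriction of) an affine map on each interval `[t i, t (i+1)]`. -/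
def IsPLTrajectory (τ : ℕ) (t : Fin (τ + 1) → ℝ) (f : ℝ → Plane) : Prop :=
  ∀ i : Fin τ, ∃ g : ℝ →ᵃ[ℝ] Plane,
    ∀ s ∈ Icc (t i.castSucc) (t i.succ), f s = g s

/-- Entities `x` and `y` are directly connected at time `s`: their `ε`-discs overlap. -/
def DirectlyConnected {n : ℕ} (p : Fin n → ℝ → Plane) (ε s : ℝ) (x y : Fin n) : Prop :=
  dist (p x s) (p y s) ≤ 2 * ε

/-- Entities `x` and `y` are `ε`-connected at time `s`: there is a sequence
`x = x_0, …, x_k = y` of entities with consecutive ones directly connected at `s`. -/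
def EpsConnected {n : ℕ} (p : Fin n → ℝ → Plane) (ε s : ℝ) : Fin n → Fin n → Prop :=
  Relation.ReflTransGen (DirectlyConnected p ε s)

/-- A component at time `s` is a maximal set of pairwise `ε`-connected entities. -/
def IsComponent {n : ℕ} (p : Fin n → ℝ → Plane) (ε s : ℝ) (C : Set (Fin n)) : Prop :=
  (∀ x ∈ C, ∀ y ∈ C, EpsConnected p ε s x y) ∧
  (∀ D : Set (Fin n), C ⊆ D → (∀ x ∈ D, ∀ y ∈ D, EpsConnected p ε s x y) → D = C)
/-- The set of times in `[t0, tτ]` at which entities `x` and `y` are directly connected.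
Its boundary points are the connect and disconnect events of the pair `x, y`. -/
def ConnTimes {n : ℕ} (p : Fin n → ℝ → Plane) (ε t0 tτ : ℝ) (x y : Fin n) : Set ℝ :=
  {s ∈ Icc t0 tτ | dist (p x s) (p y s) ≤ 2 * ε}

/-- All connect and disconnect events of all (unordered) pairs of entities occur at
pairwise distinct times. -/
def DistinctEvents {n : ℕ} (p : Fin n → ℝ → Plane) (ε t0 tτ : ℝ) : Prop :=
  ∀ x y x' y' : Fin n, x ≠ y → x' ≠ y' → ({x, y} : Finset (Fin n)) ≠ {x', y'} →
    Disjoint (frontier (ConnTimes p ε t0 tτ x y)) (frontier (ConnTimes p ε t0 tτ x' y'))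
/-- `G` is a group on the interval `[a, b] ⊆ [t0, tτ]` for parameters `ε`, `m`, `δ`:
it has at least `m` entities, the interval has length at least `δ`, and at every time
`s ∈ [a, b]` all of `G` lies in a single component. -/
def IsGroup {n : ℕ} (p : Fin n → ℝ → Plane) (ε : ℝ) (m : ℕ) (δ t0 tτ : ℝ)
    (G : Finset (Fin n)) (a b : ℝ) : Prop :=
  m ≤ G.card ∧ t0 ≤ a ∧ a ≤ b ∧ b ≤ tτ ∧ δ ≤ b - a ∧
  ∀ s ∈ Icc a b, ∃ C : Set (Fin n), IsComponent p ε s C ∧ ↑G ⊆ C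

/-- `G` is a maximal group on `[a, b]`: it is a group on `[a, b]`, and the only group
`(H, [c, d])` covering `(G, [a, b])` (i.e. with `G ⊆ H` and `[a, b] ⊆ [c, d]`) is
`(G, [a, b])` itself. -/
def IsMaximalGroup {n : ℕ} (p : Fin n → ℝ → Plane) (ε : ℝ) (m : ℕ) (δ t0 tτ : ℝ)
    (G : Finset (Fin n)) (a b : ℝ) : Prop :=
  IsGroup p ε m δ t0 tτ G a b ∧
  ∀ (H : Finset (Fin n)) (c d : ℝ), IsGroup p ε m δ t0 tτ H c d →
    G ⊆ H → c ≤ a → b ≤ d → H = G ∧ c = a ∧ d = b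

theorem laminar_card {α : Type*} [DecidableEq α] (S : Finset α) :
    ∀ F : Finset (Finset α), (∀ A ∈ F, A ⊆ S) → (∀ A ∈ F, A.Nonempty) →
      (∀ A ∈ F, ∀ B ∈ F, Disjoint A B ∨ A ⊆ B ∨ B ⊆ A) → F.card ≤ 2 * S.card := by
  induction S using Finset.induction_on with
  | empty =>
    intro F hS hne _
    have : F = ∅ := by
      apply Finset.eq_empty_of_forall_notMem
      intro A hA
      have h1 := hS A hA
      have h2 := hne A hA
      rw [Finset.subset_empty] at h1
      simp [h1] at h2
    simp [this]
  | insert x S hx ih =>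
    intro F hS hne hl
    have hle : ∀ A ∈ F, ∀ B ∈ F, x ∈ A → x ∈ B → A.erase x ∈ F → B.erase x ∈ F →
        A ⊆ B → A = B := by
      intro A hA B hB hxA hxB hA' hB' hAB
      refine Finset.Subset.antisymm hAB ?_
      obtain ⟨z, hz⟩ := hne _ hA'
      rcases hl A hA _ hB' with h | h | h
      · exact absurd (Finset.mem_erase.2 ⟨(Finset.mem_erase.1 hz).1,
          hAB (Finset.mem_erase.1 hz).2⟩)
          (Finset.disjoint_left.1 h (Finset.mem_erase.1 hz).2)
      · exact absurd (h hxA) (Finset.notMem_erase x B)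
      · intro y hy
        by_cases hyx : y = x
        · rw [hyx]; exact hxA
        · exact h (Finset.mem_erase.2 ⟨hyx, hy⟩)
    let Q : Finset α → Prop := fun A => x ∈ A ∧ A.erase x ∈ F
    classical
    have hbad : (F.filter Q).card ≤ 1 := by
      rw [Finset.card_le_one]
      intro A hA B hB
      obtain ⟨hA, hxA, hA'⟩ := Finset.mem_filter.1 hA
      obtain ⟨hB, hxB, hB'⟩ := Finset.mem_filter.1 hB
      rcases hl A hA B hB with h | h | h
      · exact absurd hxB (Finset.disjoint_left.1 h hxA)
      · exact hle A hA B hB hxA hxB hA' hB' h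
      · exact (hle B hB A hA hxB hxA hB' hA' h).symm
    let K := (F.filter (fun A => ¬ Q A)).erase {x}
    have hK : ∀ A ∈ K, A ≠ {x} ∧ A ∈ F ∧ ¬ Q A := by
      intro A hA
      obtain ⟨h1, h2⟩ := Finset.mem_erase.1 hA
      exact ⟨h1, Finset.mem_filter.1 h2⟩
    have hinj : (K.image (fun A => A.erase x)).card = K.card := by
      apply Finset.card_image_of_injOn
      intro A hA B hB hAB
      obtain ⟨_, hAF, hAQ⟩ := hK A hA
      obtain ⟨_, hBF, hBQ⟩ := hK B hB
      change A.erase x = B.erase x at hAB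
      by_cases hxA : x ∈ A <;> by_cases hxB : x ∈ B
      · rw [← Finset.insert_erase hxA, ← Finset.insert_erase hxB, hAB]
      · exact absurd ⟨hxA, by rw [hAB, Finset.erase_eq_of_notMem hxB]; exact hBF⟩ hAQ
      · exact absurd ⟨hxB, by rw [← hAB, Finset.erase_eq_of_notMem hxA]; exact hAF⟩ hBQ
      · rwa [Finset.erase_eq_of_notMem hxA, Finset.erase_eq_of_notMem hxB] at hAB
    have hI := ih (K.image (fun A => A.erase x)) (by
        intro A hA
        obtain ⟨B, hB, rfl⟩ := Finset.mem_image.1 hA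
        exact Finset.subset_insert_iff.1 (hS B (hK B hB).2.1)) (by
        intro A hA
        obtain ⟨B, hB, rfl⟩ := Finset.mem_image.1 hA
        obtain ⟨h1, h2, _⟩ := hK B hB
        by_contra hem
        rw [Finset.not_nonempty_iff_eq_empty, Finset.erase_eq_empty_iff] at hem
        rcases hem with h | h
        · exact (hne B h2).ne_empty h
        · exact h1 h) (by
        intro A hA B hB
        obtain ⟨A, hA1, rfl⟩ := Finset.mem_image.1 hA
        obtain ⟨B, hB1, rfl⟩ := Finset.mem_image.1 hB
        rcases hl A (hK A hA1).2.1 B (hK B hB1).2.1 with h | h | h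
        · exact Or.inl (h.mono (Finset.erase_subset _ _) (Finset.erase_subset _ _))
        · exact Or.inr (Or.inl (Finset.erase_subset_erase x h))
        · exact Or.inr (Or.inr (Finset.erase_subset_erase x h)))
    have h1 := Finset.card_filter_add_card_filter_not (s := F) Q
    have h2 : (F.filter (fun A => ¬ Q A)).card - 1 ≤ K.card := Finset.pred_card_le_card_erase
    rw [Finset.card_insert_of_notMem hx]
    omega

theorem EpsConnected.symm' {n : ℕ} {p : Fin n → ℝ → Plane} {ε s : ℝ} {x y : Fin n}
    (h : EpsConnected p ε s x y) : EpsConnected p ε s y x := by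
  have hs : ∀ a b, DirectlyConnected p ε s a b → DirectlyConnected p ε s b a := by
    intro a b hab
    unfold DirectlyConnected at *
    rwa [dist_comm]
  unfold EpsConnected at *
  induction h with
  | refl => exact Relation.ReflTransGen.refl
  | tail _ hbc ih => exact Relation.ReflTransGen.head (hs _ _ hbc) ih

theorem group_union {n : ℕ} {p : Fin n → ℝ → Plane} {ε : ℝ} {m : ℕ} {δ t0 t1 : ℝ}
    {G H : Finset (Fin n)} {s b b' : ℝ} (hG : IsGroup p ε m δ t0 t1 G s b)
    (hH : IsGroup p ε m δ t0 t1 H s b') (hb : b ≤ b') {x : Fin n} (hxG : x ∈ G) (hxH : x ∈ H) :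
    IsGroup p ε m δ t0 t1 (G ∪ H) s b := by
  obtain ⟨h1, h2, h3, h4, h5, h6⟩ := hG
  obtain ⟨-, -, -, -, -, k6⟩ := hH
  refine ⟨h1.trans (Finset.card_le_card Finset.subset_union_left), h2, h3, h4, h5, ?_⟩
  intro u hu
  obtain ⟨C, hC, hGC⟩ := h6 u hu
  obtain ⟨D, hD, hHD⟩ := k6 u ⟨hu.1, hu.2.trans hb⟩
  refine ⟨{y | EpsConnected p ε u x y}, ⟨?_, ?_⟩, ?_⟩
  · intro y hy z hz
    exact Relation.ReflTransGen.trans (EpsConnected.symm' hy) hz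
  · intro E hE hE'
    refine Subset.antisymm ?_ hE
    intro y hy
    exact hE' x (hE Relation.ReflTransGen.refl) y hy
  · intro y hy
    rcases Finset.mem_union.1 (Finset.mem_coe.1 hy) with h | h
    · exact hC.1 x (hGC hxG) y (hGC h)
    · exact hD.1 x (hHD hxH) y (hHD h)

theorem max_subset {n : ℕ} {p : Fin n → ℝ → Plane} {ε : ℝ} {m : ℕ} {δ t0 t1 : ℝ}
    {G H : Finset (Fin n)} {s b b' : ℝ} (hG : IsMaximalGroup p ε m δ t0 t1 G s b)
    (hH : IsMaximalGroup p ε m δ t0 t1 H s b') (hb : b ≤ b') : Disjoint G H ∨ H ⊆ G := by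
  by_cases hd : Disjoint G H
  · exact Or.inl hd
  · right
    obtain ⟨x, hxG, hxH⟩ := Finset.not_disjoint_iff.1 hd
    have := (hG.2 _ s b (group_union hG.1 hH.1 hb hxG hxH) Finset.subset_union_left
      le_rfl le_rfl).1
    rw [← this]
    exact Finset.subset_union_right

/-- There is an absolute constant `c > 0` such that for any `n` entities with
piecewise-linear trajectories of `τ` edges, any `ε ≥ 0`, `m ≥ 1`, `δ ≥ 0`, if all
connect and disconnect events of all pairs of entities occur at pairwise distinct times,
then for every time `s ∈ [t 0, t τ]` the number of distinct maximal groups `(G, I_G)`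
whose interval `I_G` has left endpoint `s` is at most `c · n`. -/
theorem stmt_10 :
    ∃ c : ℝ, 0 < c ∧
      ∀ (n τ : ℕ) (t : Fin (τ + 1) → ℝ), StrictMono t →
      ∀ (ε : ℝ), 0 ≤ ε → ∀ (m : ℕ), 1 ≤ m → ∀ (δ : ℝ), 0 ≤ δ →
      ∀ (p : Fin n → ℝ → Plane), (∀ x, IsPLTrajectory τ t (p x)) →
      DistinctEvents p ε (t 0) (t (Fin.last τ)) →
      ∀ s ∈ Icc (t 0) (t (Fin.last τ)),
        {g : Finset (Fin n) × ℝ |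
            IsMaximalGroup p ε m δ (t 0) (t (Fin.last τ)) g.1 s g.2}.Finite ∧
        ({g : Finset (Fin n) × ℝ |
            IsMaximalGroup p ε m δ (t 0) (t (Fin.last τ)) g.1 s g.2}.ncard : ℝ) ≤ c * n := by
  refine ⟨2, by norm_num, ?_⟩
  intro n τ t _ ε _ m hm δ _ p _ _ s _
  set M := {g : Finset (Fin n) × ℝ |
            IsMaximalGroup p ε m δ (t 0) (t (Fin.last τ)) g.1 s g.2} with hM
  have hinj : InjOn Prod.fst M := by
    rintro ⟨G, b⟩ hg ⟨H, b'⟩ hh (rfl : G = H)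
    have hg' : IsMaximalGroup p ε m δ (t 0) (t (Fin.last τ)) G s b := hg
    have hh' : IsMaximalGroup p ε m δ (t 0) (t (Fin.last τ)) G s b' := hh
    rcases le_total b b' with h | h
    · rw [(hg'.2 G s b' hh'.1 subset_rfl le_rfl h).2.2]
    · rw [(hh'.2 G s b hg'.1 subset_rfl le_rfl h).2.2]
  have hfin : M.Finite := Set.Finite.of_finite_image (Set.toFinite (Prod.fst '' M)) hinj
  refine ⟨hfin, ?_⟩
  classical
  have hcard : M.ncard = (hfin.toFinset.image Prod.fst).card := by
    rw [Finset.card_image_of_injOn (by simpa using hinj), Set.ncard_eq_toFinset_card M hfin]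
  have hb := laminar_card (Finset.univ : Finset (Fin n)) (hfin.toFinset.image Prod.fst)
    (fun _ _ => Finset.subset_univ _) (by
      intro A hA
      obtain ⟨⟨G, b⟩, hg, rfl⟩ := Finset.mem_image.1 hA
      have hg' : IsMaximalGroup p ε m δ (t 0) (t (Fin.last τ)) G s b := hfin.mem_toFinset.1 hg
      exact Finset.card_pos.1 (lt_of_lt_of_le hm hg'.1.1)) (by
      intro A hA B hB
      obtain ⟨⟨G, b⟩, hg, rfl⟩ := Finset.mem_image.1 hA
      obtain ⟨⟨H, b'⟩, hh, rfl⟩ := Finset.mem_image.1 hB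
      have hg' : IsMaximalGroup p ε m δ (t 0) (t (Fin.last τ)) G s b := hfin.mem_toFinset.1 hg
      have hh' : IsMaximalGroup p ε m δ (t 0) (t (Fin.last τ)) H s b' := hfin.mem_toFinset.1 hh
      rcases le_total b b' with h | h
      · rcases max_subset hg' hh' h with h | h
        · exact Or.inl h
        · exact Or.inr (Or.inr h)
      · rcases max_subset hh' hg' h with h | h
        · exact Or.inl h.symm
        · exact Or.inr (Or.inl h))
  rw [hcard]
  rw [Finset.card_univ, Fintype.card_fin] at hb
  exact_mod_cast hb
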